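/- arXiv:math/0205337 — 2 statements merged into one kernel-verified Lean document; each statement's English description precedes it below -/
import Mathlib

section
/- For m ≥ 1 let α_m : ℤ^m → (ℚ/ℤ) × ℚ be the homomorphism α_m(x_0, …, x_{m−1}) = (Σ_{i=0}^{m−1}(x_i/2 + i·x_i/m) mod ℤ, (Σ_{i=0}^{m−1} x_i)/m). Then for all m, n ≥ 1, α_{mn} ∘ δ_m^n = α_m, where δ_m^n : ℤ^m → ℤ^{mn} is the concatenation map (δ_m^n f)_k = f_{k mod m}. -/
/-- The map `α_m : ℤ^m → (ℚ/ℤ) × ℚ`,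
`α_m (x_0, …, x_{m-1}) = (Σ_i (x_i/2 + i·x_i/m) mod ℤ, (Σ_i x_i)/m)`. -/
noncomputable def alphaMap (m : ℕ) (x : Fin m → ℤ) :
    (ℚ ⧸ AddSubgroup.zmultiples (1 : ℚ)) × ℚ :=
  (QuotientAddGroup.mk' (AddSubgroup.zmultiples (1 : ℚ))
      (∑ i : Fin m, ((x i : ℚ) / 2 + ((i : ℕ) : ℚ) * (x i : ℚ) / (m : ℚ))),
    (∑ i : Fin m, (x i : ℚ)) / (m : ℚ))

/-- The concatenation map `δ_m^n : ℤ^m → ℤ^{mn}`, `(δ_m^n f) k = f (k mod m)`. -/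
def concatMap (M : Type) (m n : ℕ) [NeZero m] (f : Fin m → M) : Fin (m * n) → M :=
  fun k => f ⟨(k : ℕ) % m, Nat.mod_lt _ (Nat.pos_of_ne_zero (NeZero.ne m))⟩

/-- A sum over `Fin (m * n)` regrouped by residues modulo `m`. -/
theorem sum_fin_mul_concatMap {M A : Type} [AddCommMonoid A] (m n : ℕ) [NeZero m]
    (f : Fin m → M) (F : ℕ → M → A) :
    ∑ k : Fin (m * n), F k (concatMap M m n f k) =
      ∑ i : Fin m, ∑ j : Fin n, F (i + m * j) (f i) := by
  rw [Finset.sum_comm, ← Fintype.sum_prod_type']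
  symm
  refine Fintype.sum_equiv (finProdFinEquiv.trans (finCongr (Nat.mul_comm n m))) _ _ ?_
  rintro ⟨j, i⟩
  simp [concatMap, Nat.mod_eq_of_lt i.isLt]

theorem sum_fin_cast_rat (n : ℕ) : ∑ j : Fin n, ((j : ℕ) : ℚ) = n * (n - 1) / 2 := by
  rw [Fin.sum_univ_eq_sum_range (fun j => (j : ℚ)) n]
  induction n with
  | zero => simp
  | succ n ih => rw [Finset.sum_range_succ, ih]; push_cast; ring

/-- for all `m, n ≥ 1`, `α_{mn} ∘ δ_m^n = α_m`. -/
theorem weil_etale_stmt_15 (m n : ℕ) [NeZero m] [NeZero n] :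
    ∀ x : Fin m → ℤ, alphaMap (m * n) (concatMap ℤ m n x) = alphaMap m x := by
  intro x
  have hm : (m : ℚ) ≠ 0 := NeZero.ne _
  have hn : (n : ℚ) ≠ 0 := NeZero.ne _
  unfold alphaMap
  refine Prod.ext ?_ ?_
  · dsimp only
    rw [sum_fin_mul_concatMap m n x
      (fun k a => (a : ℚ) / 2 + (k : ℚ) * (a : ℚ) / ((m * n : ℕ) : ℚ))]
    rw [eq_comm, QuotientAddGroup.mk'_eq_mk']
    refine ⟨((n - 1 : ℤ) * ∑ i, x i : ℤ), AddSubgroup.mem_zmultiples_iff.2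
      ⟨(n - 1 : ℤ) * ∑ i, x i, by simp⟩, ?_⟩
    push_cast
    rw [Finset.mul_sum, ← Finset.sum_add_distrib]
    refine Finset.sum_congr rfl fun i _ => ?_
    simp only [add_mul, add_div, Finset.sum_add_distrib, ← Finset.sum_div, ← Finset.sum_mul,
      ← Finset.mul_sum, sum_fin_cast_rat, Finset.sum_const, Finset.card_univ, Fintype.card_fin,
      nsmul_eq_mul]
    field_simp
    ring
  · dsimp only
    rw [sum_fin_mul_concatMap m n x (fun _ a => (a : ℚ))]
    simp only [Finset.sum_const, Finset.card_univ, Fintype.card_fin, nsmul_eq_mul,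
      ← Finset.mul_sum]
    push_cast
    field_simp
end

section
/- For m ≥ 1 let α_m : ℤ^m → (ℚ/ℤ) × ℚ be the homomorphism α_m(x_0, …, x_{m−1}) = (Σ_{i=0}^{m−1}(x_i/2 + i·x_i/m) mod ℤ, (Σ_{i=0}^{m−1} x_i)/m). Then: (i) for every integer j, α_m ∘ ρ_j = τ_j ∘ α_m, where ρ_j : ℤ^m → ℤ^m is the cyclic rotation (ρ_j x)_i = x_{(i−j) mod m} and τ_j : (ℚ/ℤ) × ℚ → (ℚ/ℤ) × ℚ is τ_j(q, r) = (q + (j·r mod ℤ), r); and (ii) α_m ∘ (ρ_1 − id) = g ∘ S′_m, where g : ℚ → (ℚ/ℤ) × ℚ is g(r) = (r mod ℤ, 0) and S′_m : ℤ^m → ℚ is S′_m(x) = (Σ_{i=0}^{m−1} x_i)/m. -/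
/-- The cyclic rotation `ρ_j : ℤ^m → ℤ^m`, `(ρ_j x) i = x ((i - j) mod m)`. -/
def rhoMap (m : ℕ) [NeZero m] (j : ℤ) (x : Fin m → ℤ) : Fin m → ℤ :=
  fun i => x ⟨(((i : ℕ) - j : ℤ) % (m : ℤ)).toNat, by
    have hm : (0 : ℤ) < (m : ℤ) := by
      exact_mod_cast Nat.pos_of_ne_zero (NeZero.ne m)
    have h1 : 0 ≤ (((i : ℕ) - j : ℤ)) % (m : ℤ) := Int.emod_nonneg _ (by omega)
    have h2 : (((i : ℕ) - j : ℤ)) % (m : ℤ) < (m : ℤ) := Int.emod_lt_of_pos _ hm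
    omega⟩

/-- The map `τ_j : (ℚ/ℤ) × ℚ → (ℚ/ℤ) × ℚ`, `τ_j (q, r) = (q + (j·r mod ℤ), r)`. -/
noncomputable def tauMap (j : ℤ) (p : (ℚ ⧸ AddSubgroup.zmultiples (1 : ℚ)) × ℚ) :
    (ℚ ⧸ AddSubgroup.zmultiples (1 : ℚ)) × ℚ :=
  (p.1 + QuotientAddGroup.mk' (AddSubgroup.zmultiples (1 : ℚ)) ((j : ℚ) * p.2), p.2)

/-- The map `g : ℚ → (ℚ/ℤ) × ℚ`, `g r = (r mod ℤ, 0)`. -/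
noncomputable def gMap (r : ℚ) : (ℚ ⧸ AddSubgroup.zmultiples (1 : ℚ)) × ℚ :=
  (QuotientAddGroup.mk' (AddSubgroup.zmultiples (1 : ℚ)) r, 0)

/-- The map `S′_m : ℤ^m → ℚ`, `x ↦ (Σ_i x_i)/m`. -/
def S'map (m : ℕ) (x : Fin m → ℤ) : ℚ := (∑ i : Fin m, (x i : ℚ)) / (m : ℚ)

/-- The permutation `i ↦ (i - j) mod m` of `Fin m`. -/
def finRotateBy (m : ℕ) [NeZero m] (j : ℤ) : Equiv.Perm (Fin m) :=
  have hm : (0 : ℤ) < (m : ℤ) := by exact_mod_cast Nat.pos_of_ne_zero (NeZero.ne m)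
  have hlt (j : ℤ) (i : Fin m) : (((i : ℕ) - j : ℤ) % (m : ℤ)).toNat < m := by
    have h1 := Int.emod_nonneg ((i : ℕ) - j : ℤ) hm.ne'
    have h2 := Int.emod_lt_of_pos ((i : ℕ) - j : ℤ) hm
    omega
  have hinv (j k : ℤ) (hjk : j + k = 0) (i : Fin m) :
      (((((i : ℕ) - j : ℤ) % (m : ℤ)).toNat - k : ℤ) % (m : ℤ)).toNat = (i : ℕ) := by
    rw [Int.toNat_of_nonneg (Int.emod_nonneg _ hm.ne'), Int.emod_sub_emod,
      show ((i : ℕ) - j - k : ℤ) = (i : ℕ) by omega,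
      Int.emod_eq_of_lt (by omega) (by exact_mod_cast i.isLt), Int.toNat_natCast]
  { toFun := fun i => ⟨(((i : ℕ) - j : ℤ) % (m : ℤ)).toNat, hlt j i⟩
    invFun := fun i => ⟨(((i : ℕ) - -j : ℤ) % (m : ℤ)).toNat, hlt (-j) i⟩
    left_inv := fun i => Fin.ext (hinv j (-j) (by omega) i)
    right_inv := fun i => Fin.ext (hinv (-j) j (by omega) i) }

lemma rhoMap_apply (m : ℕ) [NeZero m] (j : ℤ) (x : Fin m → ℤ) (i : Fin m) :
    rhoMap m j x i = x (finRotateBy m j i) := rfl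

lemma exists_eq_finRotateBy_add (m : ℕ) [NeZero m] (j : ℤ) (i : Fin m) :
    ∃ c : ℤ, ((i : ℕ) : ℚ) = ((finRotateBy m j i : ℕ) : ℚ) + j + c * m := by
  have hm : (m : ℤ) ≠ 0 := by exact_mod_cast NeZero.ne m
  have h : ((finRotateBy m j i : ℕ) : ℤ) = ((i : ℕ) - j : ℤ) % (m : ℤ) :=
    Int.toNat_of_nonneg (Int.emod_nonneg _ hm)
  refine ⟨((i : ℕ) - j : ℤ) / (m : ℤ), ?_⟩
  have h2 := Int.emod_add_mul_ediv ((i : ℕ) - j : ℤ) (m : ℤ)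
  rw [← h] at h2
  have h3 : ((i : ℕ) : ℤ) = (finRotateBy m j i : ℕ) + j + ((i : ℕ) - j : ℤ) / (m : ℤ) * m := by
    linarith
  exact_mod_cast h3

lemma alphaMap_rhoMap (m : ℕ) [NeZero m] (j : ℤ) (x : Fin m → ℤ) :
    alphaMap m (rhoMap m j x) = tauMap j (alphaMap m x) := by
  have hm : (m : ℚ) ≠ 0 := by exact_mod_cast NeZero.ne m
  choose c hc using exists_eq_finRotateBy_add m j
  refine Prod.ext ?_ ?_
  · simp only [alphaMap, tauMap, ← map_add]
    refine (QuotientAddGroup.mk'_eq_mk' _).2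
      ⟨((-∑ i, c i * x (finRotateBy m j i) : ℤ) : ℚ), ⟨-∑ i, c i * x (finRotateBy m j i), by simp⟩, ?_⟩
    rw [← Equiv.sum_comp (finRotateBy m j)
        (fun i => (x i : ℚ) / 2 + ((i : ℕ) : ℚ) * (x i : ℚ) / (m : ℚ)),
      ← Equiv.sum_comp (finRotateBy m j) (fun i => (x i : ℚ))]
    push_cast
    rw [Finset.sum_div, Finset.mul_sum, ← Finset.sum_neg_distrib, ← Finset.sum_add_distrib,
      ← Finset.sum_add_distrib]
    refine Finset.sum_congr rfl fun i _ => ?_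
    rw [rhoMap_apply, hc i]
    field_simp
    ring
  · simp only [alphaMap, tauMap, rhoMap_apply]
    rw [Equiv.sum_comp (finRotateBy m j) (fun i => (x i : ℚ))]

lemma alphaMap_sub (m : ℕ) (x y : Fin m → ℤ) :
    alphaMap m (x - y) = alphaMap m x - alphaMap m y := by
  refine Prod.ext ?_ ?_
  · simp only [alphaMap, Prod.fst_sub, ← map_sub, ← Finset.sum_sub_distrib]
    refine congrArg _ (Finset.sum_congr rfl fun i _ => ?_)
    push_cast [Pi.sub_apply]
    ring
  · simp [alphaMap, sub_div]

/-- (i) for every integer `j`, `α_m ∘ ρ_j = τ_j ∘ α_m`; and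
(ii) `α_m ∘ (ρ_1 - id) = g ∘ S′_m`. -/
theorem weil_etale_stmt_16 (m : ℕ) [NeZero m] :
    (∀ (j : ℤ) (x : Fin m → ℤ), alphaMap m (rhoMap m j x) = tauMap j (alphaMap m x)) ∧
    (∀ x : Fin m → ℤ, alphaMap m (rhoMap m 1 x - x) = gMap (S'map m x)) := by
  refine ⟨alphaMap_rhoMap m, fun x => ?_⟩
  rw [alphaMap_sub, alphaMap_rhoMap]
  refine Prod.ext ?_ ?_ <;> simp [tauMap, gMap, S'map, alphaMap]
end
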